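/- Fix ρ₀ ∈ ℂ with |ρ₀| ≤ 1, ε > 0, and z ∈ ℂ∖𝓔_{ρ₀,ε}. Suppose that for each η ∈ (0,1) we are given V(η) > 0 and b(η) ∈ ℂ satisfying V(η)·(1 − 1/(V(η)² + |b(η)|²)) + η = 0 and conj(b(η))·ρ₀ + b(η)/(V(η)² + |b(η)|²) + z = 0. Then lim_{η → 0⁺} V(η) = 0 and lim_{η → 0⁺} conj(b(η)) = m_{ρ₀}(z). -/

import Mathlib

open scoped Classical
open Filter

noncomputable section

/-- The elliptic region 𝓔_ρ := {z ∈ ℂ : z = x + ρ·conj(x) for some |x| ≤ 1}. -/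
def ellipticSet (ρ : ℂ) : Set ℂ :=
  {z | ∃ x : ℂ, ‖x‖ ≤ 1 ∧ z = x + ρ * (starRingEnd ℂ) x}

/-- The ε-neighborhood 𝓔_{ρ,ε}. -/
def ellipticNbhd (ρ : ℂ) (ε : ℝ) : Set ℂ :=
  {z | Metric.infDist z (ellipticSet ρ) ≤ ε}

/-- m_ρ(z): for ρ ≠ 0 the unique root w of ρw² + zw + 1 = 0 with |w| < 1; m₀(z) = −1/z. -/
def mRho (ρ z : ℂ) : ℂ :=
  if ρ = 0 then -z⁻¹
  else if h : ∃ w : ℂ, ρ * w ^ 2 + z * w + 1 = 0 ∧ ‖w‖ < 1 then h.choose else 0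

theorem key_bounds (ρ z : ℂ) (ε : ℝ) (hε : 0 < ε) (hz : z ∉ ellipticNbhd ρ ε)
    (v η : ℝ) (b : ℂ) (hη : 0 < η) (hv : 0 < v)
    (h1 : v * (1 - 1 / (v ^ 2 + ‖b‖ ^ 2)) + η = 0)
    (h2 : (starRingEnd ℂ) b * ρ + b / ((v : ℂ) ^ 2 + ((‖b‖ : ℝ) : ℂ) ^ 2) + z = 0) :
    ‖b‖ ≤ 1 ∧ v ≤ η / ε ∧
    ρ * ((starRingEnd ℂ) b) ^ 2 + z * (starRingEnd ℂ) b + 1 = ((v * (v + η) : ℝ) : ℂ) := by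
  have hs : 0 < v ^ 2 + ‖b‖ ^ 2 := by positivity
  obtain ⟨s, hsd⟩ : ∃ s, s = v ^ 2 + ‖b‖ ^ 2 := ⟨_, rfl⟩
  have hsc : ((v : ℂ) ^ 2 + ((‖b‖ : ℝ) : ℂ) ^ 2) = (s : ℂ) := by rw [hsd]; push_cast; rfl
  rw [hsc] at h2
  rw [← hsd] at h1 hs
  obtain ⟨t, ht⟩ : ∃ t, t = 1 / s := ⟨_, rfl⟩
  have hts : t * s = 1 := by rw [ht]; field_simp
  have h2' : (starRingEnd ℂ) b * ρ + b * (t : ℂ) + z = 0 := by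
    rw [← h2, ht]; push_cast; ring
  rw [← ht] at h1
  have hvt : v * (t - 1) = η := by linarith
  have ht1 : 0 < t - 1 := by
    by_contra hc
    have := mul_nonneg hv.le (sub_nonneg.2 (not_lt.1 hc))
    nlinarith
  have hs1 : s < 1 := by nlinarith
  have hb : ‖b‖ ≤ 1 := by
    have : 0 ≤ ‖b‖ := norm_nonneg b
    nlinarith [sq_nonneg v]
  refine ⟨hb, ?_, ?_⟩
  · have hmem : -b + ρ * (starRingEnd ℂ) (-b) ∈ ellipticSet ρ := ⟨-b, by simpa using hb, rfl⟩
    have hd := Metric.infDist_le_dist_of_mem (x := z) hmem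
    have he : ε < Metric.infDist z (ellipticSet ρ) := not_le.1 hz
    have heq : z - (-b + ρ * (starRingEnd ℂ) (-b)) = -(b * ((t - 1 : ℝ) : ℂ)) := by
      simp only [map_neg]; push_cast; linear_combination h2'
    rw [dist_eq_norm, heq, norm_neg, norm_mul, Complex.norm_real, Real.norm_of_nonneg ht1.le] at hd
    have : ε ≤ t - 1 := by nlinarith
    rw [le_div_iff₀ hε]
    nlinarith
  · have hbb : (starRingEnd ℂ) b * b = ((s - v ^ 2 : ℝ) : ℂ) := by
      rw [mul_comm, Complex.mul_conj, Complex.normSq_eq_norm_sq, hsd]; congr 1; ring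
    have h3 : (s - v ^ 2) * t = 1 - v * (v + η) := by
      linear_combination hts - v * hvt
    have h3' : ((s - v ^ 2 : ℝ) : ℂ) * (t : ℂ) = 1 - ((v * (v + η) : ℝ) : ℂ) := by
      exact_mod_cast h3
    linear_combination (starRingEnd ℂ) b * h2' - (t : ℂ) * hbb - h3'

theorem root_dist (ρ z m u : ℂ) (hρ : ‖ρ‖ ≤ 1) (hm : ρ * m ^ 2 + z * m + 1 = 0)
    (hm1 : ‖m‖ < 1) (hu : ‖u‖ ≤ 1) :
    ‖u - m‖ ≤ ‖ρ * u ^ 2 + z * u + 1‖ / (1 - ‖m‖) := by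
  have h1 : m * (ρ * u ^ 2 + z * u + 1) = (u - m) * (ρ * u * m - 1) := by
    linear_combination u * hm
  have h2 := congrArg norm h1
  rw [norm_mul, norm_mul] at h2
  have h3 : 1 - ‖m‖ ≤ ‖ρ * u * m - 1‖ := by
    have h4 : ‖ρ * u * m‖ ≤ ‖m‖ := by
      rw [norm_mul, norm_mul]
      have : ‖ρ‖ * ‖u‖ ≤ 1 := mul_le_one₀ hρ (norm_nonneg _) hu
      exact mul_le_of_le_one_left (norm_nonneg _) this
    have h5 := norm_sub_norm_le (1 : ℂ) (ρ * u * m)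
    rw [norm_one, norm_sub_rev] at h5
    linarith
  rw [le_div_iff₀ (by linarith)]
  calc ‖u - m‖ * (1 - ‖m‖) ≤ ‖u - m‖ * ‖ρ * u * m - 1‖ := by gcongr
    _ = ‖m‖ * ‖ρ * u ^ 2 + z * u + 1‖ := h2.symm
    _ ≤ _ := mul_le_of_le_one_left (norm_nonneg _) hm1.le

theorem mRho_spec (ρ z : ℂ) (h : ∃ w : ℂ, ρ * w ^ 2 + z * w + 1 = 0 ∧ ‖w‖ < 1) :
    ρ * mRho ρ z ^ 2 + z * mRho ρ z + 1 = 0 ∧ ‖mRho ρ z‖ < 1 := by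
  by_cases h0 : ρ = 0
  · obtain ⟨w, hw, hw1⟩ := h
    have hz : z ≠ 0 := by rintro rfl; simp [h0] at hw
    have : mRho ρ z = w := by
      rw [mRho, if_pos h0]
      rw [h0] at hw
      field_simp
      linear_combination -hw
    rw [this]; exact ⟨hw, hw1⟩
  · rw [mRho, if_neg h0, dif_pos h]
    exact h.choose_spec

/-- Small-η asymptotics of solutions of the scalar Dyson equations at z ∉ 𝓔_{ρ₀,ε}:
V(η) → 0 and conj(b(η)) → m_{ρ₀}(z) as η → 0⁺. -/
theorem stmt18 (ρ₀ : ℂ) (hρ : ‖ρ₀‖ ≤ 1) (ε : ℝ) (hε : 0 < ε)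
    (z : ℂ) (hz : z ∉ ellipticNbhd ρ₀ ε)
    (V : ℝ → ℝ) (b : ℝ → ℂ)
    (hsol : ∀ η ∈ Set.Ioo (0 : ℝ) 1, 0 < V η ∧
      V η * (1 - 1 / (V η ^ 2 + ‖b η‖ ^ 2)) + η = 0 ∧
      (starRingEnd ℂ) (b η) * ρ₀ +
        b η / (((V η : ℝ) : ℂ) ^ 2 + ((‖b η‖ : ℝ) : ℂ) ^ 2) + z = 0) :
    Tendsto V (nhdsWithin 0 (Set.Ioi 0)) (nhds 0) ∧
    Tendsto (fun η => (starRingEnd ℂ) (b η)) (nhdsWithin 0 (Set.Ioi 0))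
      (nhds (mRho ρ₀ z)) := by
  have hK := fun η (hη : η ∈ Set.Ioo (0 : ℝ) 1) =>
    key_bounds ρ₀ z ε hε hz (V η) η (b η) hη.1 (hsol η hη).1 (hsol η hη).2.1 (hsol η hη).2.2
  have hev : ∀ᶠ η in nhdsWithin (0 : ℝ) (Set.Ioi 0), η ∈ Set.Ioo (0 : ℝ) 1 :=
    Ioo_mem_nhdsGT one_pos
  have hid : Tendsto (fun η : ℝ => η) (nhdsWithin 0 (Set.Ioi 0)) (nhds 0) :=
    tendsto_nhdsWithin_of_tendsto_nhds tendsto_id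
  have hV : Tendsto V (nhdsWithin 0 (Set.Ioi 0)) (nhds 0) := by
    refine tendsto_of_tendsto_of_tendsto_of_le_of_le' tendsto_const_nhds
      (by simpa using hid.div_const ε : Tendsto (fun η => η / ε) _ (nhds 0)) ?_ ?_
    · filter_upwards [hev] with η hη using (hsol η hη).1.le
    · filter_upwards [hev] with η hη using (hK η hη).2.1
  refine ⟨hV, ?_⟩
  have hP : Tendsto (fun η => ρ₀ * ((starRingEnd ℂ) (b η)) ^ 2 + z * (starRingEnd ℂ) (b η) + 1)
      (nhdsWithin 0 (Set.Ioi 0)) (nhds 0) := by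
    have h1 : Tendsto (fun η => V η * (V η + η)) (nhdsWithin 0 (Set.Ioi 0)) (nhds 0) := by
      simpa using hV.mul (hV.add hid)
    have h2 := (Complex.continuous_ofReal.tendsto 0).comp h1
    rw [Complex.ofReal_zero] at h2
    refine h2.congr' ?_
    filter_upwards [hev] with η hη using (hK η hη).2.2.symm
  have hex : ∃ w : ℂ, ρ₀ * w ^ 2 + z * w + 1 = 0 ∧ ‖w‖ < 1 := by
    have hle : Filter.map (fun η => (starRingEnd ℂ) (b η)) (nhdsWithin 0 (Set.Ioi 0)) ≤
        Filter.principal (Metric.closedBall (0 : ℂ) 1) := by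
      rw [Filter.le_principal_iff, Filter.mem_map]
      filter_upwards [hev] with η hη
      simpa using (hK η hη).1
    obtain ⟨w, hw, hcl⟩ := (isCompact_closedBall (0 : ℂ) 1) hle
    have hw1 : ‖w‖ ≤ 1 := by simpa using hw
    have hroot : ρ₀ * w ^ 2 + z * w + 1 = 0 := by
      have hc : ContinuousAt (fun w : ℂ => ρ₀ * w ^ 2 + z * w + 1) w := by fun_prop
      have h3 : ClusterPt (ρ₀ * w ^ 2 + z * w + 1) (nhds (0 : ℂ)) :=
        ClusterPt.map (f := fun w : ℂ => ρ₀ * w ^ 2 + z * w + 1) hcl hc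
          (Filter.tendsto_map'_iff.2 hP)
      exact eq_of_nhds_neBot h3
    refine ⟨w, hroot, lt_of_le_of_ne hw1 fun hw2 => hz ?_⟩
    have hww : w * (starRingEnd ℂ) w = 1 := by
      rw [Complex.mul_conj, Complex.normSq_eq_norm_sq, hw2]; simp
    have hmem : z ∈ ellipticSet ρ₀ := by
      refine ⟨-(starRingEnd ℂ) w, by simpa using hw1, ?_⟩
      simp only [map_neg, Complex.conj_conj]
      linear_combination (starRingEnd ℂ) w * hroot - (ρ₀ * w + z) * hww
    show Metric.infDist z (ellipticSet ρ₀) ≤ ε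
    rw [Metric.infDist_zero_of_mem hmem]; exact hε.le
  obtain ⟨hm, hm1⟩ := mRho_spec ρ₀ z hex
  rw [tendsto_iff_norm_sub_tendsto_zero]
  refine squeeze_zero' (Eventually.of_forall fun _ => norm_nonneg _) ?_
    (by simpa using hP.norm.div_const (1 - ‖mRho ρ₀ z‖))
  filter_upwards [hev] with η hη
  exact root_dist ρ₀ z _ _ hρ hm hm1 (by simpa using (hK η hη).1)

end
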